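/- arXiv:2411.13914 — 3 statements merged into one kernel-verified Lean document; each statement's English description precedes it below -/
import Mathlib

section
/- Let n, m be positive integers and c > 0. Let F : ℝⁿ × ℝᵐ → ℝⁿ be such that for every u ∈ ℝᵐ the map x ↦ F(x,u) is differentiable with (Fréchet) derivative J(x,u) : ℝⁿ → ℝⁿ, and suppose that for all x ∈ ℝⁿ, u ∈ ℝᵐ and v ∈ ℝⁿ one has ⟪v, J(x,u) v⟫ ≤ -c‖v‖². Let u : ℝ → ℝᵐ be any input signal, and let x₁, x₂ : ℝ → ℝⁿ be differentiable curves satisfying x₁'(t) = F(x₁(t), u(t)) and x₂'(t) = F(x₂(t), u(t)) for all t ≥ 0. Then ‖x₁(t) - x₂(t)‖ ≤ exp(-c t) · ‖x₁(0) - x₂(0)‖ for all t ≥ 0; in particular x₁(t) - x₂(t) → 0 as t → ∞ (contraction of the system ẋ = F(x,u)). -/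
open Real Filter
open scoped RealInnerProductSpace

/-- One-sided Lipschitz bound from a bound on the quadratic form of the derivative. -/
theorem one_sided_lipschitz {E : Type*} [NormedAddCommGroup E] [InnerProductSpace ℝ E]
    (c : ℝ) (f : E → E) (J : E → (E →L[ℝ] E)) (hJ : ∀ x, HasFDerivAt f (J x) x)
    (hneg : ∀ x v, ⟪v, J x v⟫ ≤ -c * ‖v‖ ^ 2) (a b : E) :
    ⟪a - b, f a - f b⟫ ≤ -c * ‖a - b‖ ^ 2 := by
  have hd : ∀ s : ℝ, HasDerivAt (fun s : ℝ => ⟪a - b, f (b + s • (a - b))⟫ + s * (c * ‖a - b‖ ^ 2))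
      (⟪a - b, J (b + s • (a - b)) (a - b)⟫ + c * ‖a - b‖ ^ 2) s := by
    intro s
    have h1 : HasDerivAt (fun s : ℝ => b + s • (a - b)) (a - b) s := by
      simpa using ((hasDerivAt_id s).smul_const (a - b)).const_add b
    have h2 : HasDerivAt (fun s : ℝ => f (b + s • (a - b))) (J (b + s • (a - b)) (a - b)) s :=
      (hJ (b + s • (a - b))).comp_hasDerivAt s h1
    have h3 := (hasDerivAt_const s (a - b)).inner ℝ h2
    have h4 := (hasDerivAt_id s).mul_const (c * ‖a - b‖ ^ 2)
    have h5 := h3.add h4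
    rw [inner_zero_left, add_zero, one_mul] at h5
    exact h5
  have hanti := antitone_of_deriv_nonpos (fun s => (hd s).differentiableAt) (fun s => by
    rw [(hd s).deriv]
    have := hneg (b + s • (a - b)) (a - b)
    linarith)
  have h := hanti (zero_le_one (α := ℝ))
  simp only [one_smul, zero_smul, add_zero, add_sub_cancel, one_mul, zero_mul] at h
  rw [inner_sub_right]
  linarith

/-- **Corollary 1 (contraction of the neural ODE `ẋ = F(x,u)`).**
If for every input `u` the map `x ↦ F(x,u)` has derivative `J(x,u)` whose quadratic form
satisfies `⟪v, J(x,u) v⟫ ≤ -c‖v‖²`, then any two solutions driven by the same input signal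
converge to each other exponentially. -/
theorem contraction_of_jacobian_neg
    (n m : ℕ) (hn : 0 < n) (hm : 0 < m) (c : ℝ) (hc : 0 < c)
    (F : EuclideanSpace ℝ (Fin n) × EuclideanSpace ℝ (Fin m) → EuclideanSpace ℝ (Fin n))
    (J : EuclideanSpace ℝ (Fin n) → EuclideanSpace ℝ (Fin m) →
      (EuclideanSpace ℝ (Fin n) →L[ℝ] EuclideanSpace ℝ (Fin n)))
    (hJ : ∀ (x : EuclideanSpace ℝ (Fin n)) (u : EuclideanSpace ℝ (Fin m)),
      HasFDerivAt (fun y => F (y, u)) (J x u) x)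
    (hneg : ∀ (x : EuclideanSpace ℝ (Fin n)) (u : EuclideanSpace ℝ (Fin m))
      (v : EuclideanSpace ℝ (Fin n)), ⟪v, J x u v⟫ ≤ -c * ‖v‖ ^ 2)
    (u : ℝ → EuclideanSpace ℝ (Fin m))
    (x₁ x₂ : ℝ → EuclideanSpace ℝ (Fin n))
    (hx₁d : Differentiable ℝ x₁) (hx₂d : Differentiable ℝ x₂)
    (hx₁ : ∀ t : ℝ, 0 ≤ t → HasDerivAt x₁ (F (x₁ t, u t)) t)
    (hx₂ : ∀ t : ℝ, 0 ≤ t → HasDerivAt x₂ (F (x₂ t, u t)) t) :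
    (∀ t : ℝ, 0 ≤ t → ‖x₁ t - x₂ t‖ ≤ Real.exp (-c * t) * ‖x₁ 0 - x₂ 0‖) ∧
      Tendsto (fun t => x₁ t - x₂ t) atTop (nhds 0) := by
  have key : ∀ t : ℝ, 0 ≤ t → ‖x₁ t - x₂ t‖ ≤ Real.exp (-c * t) * ‖x₁ 0 - x₂ 0‖ := by
    have hd : ∀ t : ℝ, 0 ≤ t → HasDerivAt (fun t => Real.exp (2 * c * t) * ‖x₁ t - x₂ t‖ ^ 2)
        (Real.exp (2 * c * t) * (2 * c) * ‖x₁ t - x₂ t‖ ^ 2 +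
          Real.exp (2 * c * t) * (2 * ⟪x₁ t - x₂ t, F (x₁ t, u t) - F (x₂ t, u t)⟫)) t := by
      intro t ht
      have h1 : HasDerivAt (fun t : ℝ => Real.exp (2 * c * t))
          (Real.exp (2 * c * t) * (2 * c)) t := by
        simpa using ((hasDerivAt_id t).const_mul (2 * c)).exp
      exact h1.mul ((hx₁ t ht).sub (hx₂ t ht)).norm_sq
    have hanti : AntitoneOn (fun t => Real.exp (2 * c * t) * ‖x₁ t - x₂ t‖ ^ 2) (Set.Ici 0) := by
      apply antitoneOn_of_deriv_nonpos (convex_Ici 0)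
      · intro t ht
        exact (hd t ht).continuousAt.continuousWithinAt
      · intro t ht
        exact (hd t (interior_subset ht)).differentiableAt.differentiableWithinAt
      · intro t ht
        rw [(hd t (interior_subset ht)).deriv]
        have h := one_sided_lipschitz c (fun y => F (y, u t)) (fun x => J x (u t))
          (fun x => hJ x (u t)) (fun x v => hneg x (u t) v) (x₁ t) (x₂ t)
        have he := Real.exp_pos (2 * c * t)
        nlinarith [mul_le_mul_of_nonneg_left h he.le]
    intro t ht
    have h := hanti (Set.mem_Ici.2 le_rfl) (Set.mem_Ici.2 ht) ht
    simp only [mul_zero, Real.exp_zero, one_mul] at h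
    have e1 : Real.exp (2 * c * t) = Real.exp (c * t) ^ 2 := by
      rw [← Real.exp_nat_mul]; congr 1; push_cast; ring
    rw [e1, ← mul_pow] at h
    have h' := (sq_le_sq₀ (by positivity) (by positivity)).1 h
    have e2 : Real.exp (-c * t) * Real.exp (c * t) = 1 := by
      rw [← Real.exp_add]; simp
    calc ‖x₁ t - x₂ t‖ = Real.exp (-c * t) * (Real.exp (c * t) * ‖x₁ t - x₂ t‖) := by
          rw [← mul_assoc, e2, one_mul]
      _ ≤ _ := mul_le_mul_of_nonneg_left h' (Real.exp_pos _).le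
  refine ⟨key, ?_⟩
  have hlim : Tendsto (fun t : ℝ => Real.exp (-c * t) * ‖x₁ 0 - x₂ 0‖) atTop (nhds 0) := by
    have h1 : Tendsto (fun t : ℝ => -c * t) atTop atBot :=
      tendsto_id.const_mul_atTop_of_neg (neg_lt_zero.2 hc)
    simpa using (Real.tendsto_exp_atBot.comp h1).mul_const ‖x₁ 0 - x₂ 0‖
  refine squeeze_zero_norm' ?_ hlim
  filter_upwards [eventually_ge_atTop 0] with t ht using key t ht
end

section
/- Let n be a positive integer, c > 0 and μ > 0. Let J : ℝ → (ℝⁿ →L[ℝ] ℝⁿ), and let L : ℝ → (ℝⁿ →L[ℝ] ℝⁿ) be a differentiable family of invertible linear maps with derivative L'(t) such that: (i) the metric is uniformly positive definite, i.e. ⟪L(t) v, L(t) v⟫ ≥ μ ‖v‖² for all t ≥ 0 and v ∈ ℝⁿ; and (ii) setting R(t) := L(t) ∘ J(t) ∘ L(t)⁻¹ + L'(t) ∘ L(t)⁻¹, one has ⟪w, R(t) w⟫ ≤ -c‖w‖² for all t ≥ 0 and w ∈ ℝⁿ. Then every differentiable δx : ℝ → ℝⁿ satisfying δx'(t) = J(t)(δx(t))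 for all t ≥ 0 obeys ‖δx(t)‖ ≤ μ^(-1/2) · exp(-c t) · ‖L(0)(δx(0))‖ for all t ≥ 0; in particular δx(t) → 0 exponentially as t → ∞. -/
open Real Filter
open scoped RealInnerProductSpace

/-- **Theorem 1 of the paper (contraction via a uniformly positive definite metric).**
If `L(t)` is a differentiable family of invertible linear maps defining a uniformly positive
definite metric (`⟪L v, L v⟫ ≥ μ‖v‖²`), and the symmetric part of
`R(t) = L(t) J(t) L(t)⁻¹ + L'(t) L(t)⁻¹` satisfies `⟪w, R(t) w⟫ ≤ -c‖w‖²`, then every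
solution of the variational equation `δx' = J(t) δx` converges exponentially to `0`. -/
theorem contraction_under_metric_transformation
    (n : ℕ) (hn : 0 < n) (c μ : ℝ) (hc : 0 < c) (hμ : 0 < μ)
    (J : ℝ → (EuclideanSpace ℝ (Fin n) →L[ℝ] EuclideanSpace ℝ (Fin n)))
    (L : ℝ → (EuclideanSpace ℝ (Fin n) ≃L[ℝ] EuclideanSpace ℝ (Fin n)))
    (L' : ℝ → (EuclideanSpace ℝ (Fin n) →L[ℝ] EuclideanSpace ℝ (Fin n)))
    (hL : ∀ t : ℝ, HasDerivAt
      (fun s => (L s : EuclideanSpace ℝ (Fin n) →L[ℝ] EuclideanSpace ℝ (Fin n))) (L' t) t)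
    (hpos : ∀ t : ℝ, 0 ≤ t → ∀ v : EuclideanSpace ℝ (Fin n),
      μ * ‖v‖ ^ 2 ≤ ⟪L t v, L t v⟫)
    (hneg : ∀ t : ℝ, 0 ≤ t → ∀ w : EuclideanSpace ℝ (Fin n),
      ⟪w, (((L t : EuclideanSpace ℝ (Fin n) →L[ℝ] EuclideanSpace ℝ (Fin n)).comp (J t)).comp
            ((L t).symm : EuclideanSpace ℝ (Fin n) →L[ℝ] EuclideanSpace ℝ (Fin n))
          + (L' t).comp
            ((L t).symm : EuclideanSpace ℝ (Fin n) →L[ℝ] EuclideanSpace ℝ (Fin n))) w⟫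
        ≤ -c * ‖w‖ ^ 2)
    (δx : ℝ → EuclideanSpace ℝ (Fin n))
    (hδxd : Differentiable ℝ δx)
    (hδx : ∀ t : ℝ, 0 ≤ t → HasDerivAt δx (J t (δx t)) t) :
    (∀ t : ℝ, 0 ≤ t →
      ‖δx t‖ ≤ (Real.sqrt μ)⁻¹ * Real.exp (-c * t) * ‖L 0 (δx 0)‖) ∧
      Tendsto δx atTop (nhds 0) := by
  have hz : ∀ t : ℝ, 0 ≤ t → HasDerivAt (fun s => L s (δx s))
      (L' t (δx t) + L t (J t (δx t))) t := by
    intro t ht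
    exact (hL t).clm_apply (hδx t ht)
  have hzn : ∀ t : ℝ, 0 ≤ t →
      ⟪L t (δx t), L' t (δx t) + L t (J t (δx t))⟫ ≤ -c * ‖L t (δx t)‖ ^ 2 := by
    intro t ht
    have h := hneg t ht (L t (δx t))
    simp only [ContinuousLinearMap.add_apply, ContinuousLinearMap.comp_apply,
      ContinuousLinearEquiv.coe_coe, ContinuousLinearEquiv.symm_apply_apply] at h
    rw [add_comm]
    exact h
  have hV : ∀ t : ℝ, 0 ≤ t → HasDerivAt
      (fun s => Real.exp (2 * c * s) * ‖L s (δx s)‖ ^ 2)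
      (Real.exp (2 * c * t) * (2 * c) * ‖L t (δx t)‖ ^ 2 + Real.exp (2 * c * t) *
        (2 * ⟪L t (δx t), L' t (δx t) + L t (J t (δx t))⟫)) t := by
    intro t ht
    have h1 : HasDerivAt (fun s : ℝ => Real.exp (2 * c * s))
        (Real.exp (2 * c * t) * (2 * c)) t := by
      have := ((hasDerivAt_id t).const_mul (2 * c)).exp
      simpa using this
    exact h1.mul (hz t ht).norm_sq
  have hanti : AntitoneOn (fun s => Real.exp (2 * c * s) * ‖L s (δx s)‖ ^ 2) (Set.Ici 0) := by
    apply antitoneOn_of_deriv_nonpos (convex_Ici 0)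
    · intro t ht
      exact (hV t ht).continuousAt.continuousWithinAt
    · intro t ht
      rw [interior_Ici] at ht
      exact (hV t (le_of_lt ht)).differentiableAt.differentiableWithinAt
    · intro t ht
      rw [interior_Ici] at ht
      have ht' : (0 : ℝ) ≤ t := le_of_lt ht
      rw [(hV t ht').deriv]
      have h := mul_le_mul_of_nonneg_left (hzn t ht') (Real.exp_pos (2 * c * t)).le
      linarith
  have hbound : ∀ t : ℝ, 0 ≤ t →
      ‖δx t‖ ≤ (Real.sqrt μ)⁻¹ * Real.exp (-c * t) * ‖L 0 (δx 0)‖ := by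
    intro t ht
    have h1 := hanti (Set.mem_Ici.2 le_rfl) (Set.mem_Ici.2 ht) ht
    simp only [mul_zero, Real.exp_zero, one_mul] at h1
    have h2 := hpos t ht (δx t)
    rw [real_inner_self_eq_norm_sq] at h2
    have he : Real.exp (2 * c * t) = Real.exp (c * t) ^ 2 := by
      rw [← Real.exp_nat_mul]
      congr 1
      push_cast
      ring
    have hs : 0 < Real.sqrt μ := Real.sqrt_pos.2 hμ
    have hE : 0 < Real.exp (c * t) := Real.exp_pos _
    have h3 : (Real.exp (c * t) * (Real.sqrt μ * ‖δx t‖)) ^ 2 ≤ ‖L 0 (δx 0)‖ ^ 2 := by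
      rw [mul_pow, mul_pow, Real.sq_sqrt hμ.le, ← he]
      exact (mul_le_mul_of_nonneg_left h2 (Real.exp_pos _).le).trans h1
    have h4 := (le_abs_self _).trans (abs_le_of_sq_le_sq h3 (norm_nonneg _))
    have h5 : Real.exp (-c * t) = (Real.exp (c * t))⁻¹ := by
      rw [← Real.exp_neg]
      congr 1
      ring
    calc ‖δx t‖ = (Real.sqrt μ)⁻¹ * (Real.exp (c * t))⁻¹ *
          (Real.exp (c * t) * (Real.sqrt μ * ‖δx t‖)) := by field_simp
      _ ≤ (Real.sqrt μ)⁻¹ * Real.exp (-c * t) * ‖L 0 (δx 0)‖ := by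
        rw [h5]
        gcongr
  refine ⟨hbound, ?_⟩
  have hlim : Tendsto (fun t : ℝ => (Real.sqrt μ)⁻¹ * Real.exp (-c * t) * ‖L 0 (δx 0)‖)
      atTop (nhds 0) := by
    have h1 : Tendsto (fun t : ℝ => Real.exp (-c * t)) atTop (nhds 0) :=
      Real.tendsto_exp_atBot.comp (tendsto_id.const_mul_atTop_of_neg (neg_lt_zero.2 hc))
    simpa using (h1.const_mul (Real.sqrt μ)⁻¹).mul_const ‖L 0 (δx 0)‖
  refine squeeze_zero_norm' ?_ hlim
  filter_upwards [eventually_ge_atTop (0 : ℝ)] with t ht using hbound t ht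
end

section
/- Let n, m be positive integers and c > 0. Let F : ℝⁿ × ℝᵐ → ℝⁿ be such that for every u ∈ ℝᵐ the map x ↦ F(x,u) is differentiable with derivative J(x,u), and suppose ⟪v, J(x,u) v⟫ ≤ -c‖v‖² for all x ∈ ℝⁿ, u ∈ ℝᵐ, v ∈ ℝⁿ. Fix a constant input u ∈ ℝᵐ and suppose x* ∈ ℝⁿ is an equilibrium, i.e. F(x*, u) = 0. Then every differentiable solution x : ℝ → ℝⁿ of x'(t) = F(x(t), u) satisfies ‖x(t) - x*‖ ≤ exp(-c t) · ‖x(0) - x*‖ for all t ≥ 0; in particular every trajectory converges exponentially to the fixed point x*, regardless of its initial condition. -/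
open Real Filter
open scoped RealInnerProductSpace

/-- **Exponential convergence of trajectories to a fixed point.**
Under the contraction condition `⟪v, J(x,u) v⟫ ≤ -c‖v‖²` of Corollary 1, for a constant
input `u` with equilibrium `x*` (i.e. `F(x*, u) = 0`), every solution of `x' = F(x, u)`
converges exponentially to `x*`, regardless of its initial condition. -/
theorem trajectories_converge_to_fixed_point
    (n m : ℕ) (hn : 0 < n) (hm : 0 < m) (c : ℝ) (hc : 0 < c)
    (F : EuclideanSpace ℝ (Fin n) × EuclideanSpace ℝ (Fin m) → EuclideanSpace ℝ (Fin n))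
    (J : EuclideanSpace ℝ (Fin n) → EuclideanSpace ℝ (Fin m) →
      (EuclideanSpace ℝ (Fin n) →L[ℝ] EuclideanSpace ℝ (Fin n)))
    (hJ : ∀ (x : EuclideanSpace ℝ (Fin n)) (u : EuclideanSpace ℝ (Fin m)),
      HasFDerivAt (fun y => F (y, u)) (J x u) x)
    (hneg : ∀ (x : EuclideanSpace ℝ (Fin n)) (u : EuclideanSpace ℝ (Fin m))
      (v : EuclideanSpace ℝ (Fin n)), ⟪v, J x u v⟫ ≤ -c * ‖v‖ ^ 2)
    (u : EuclideanSpace ℝ (Fin m)) (xstar : EuclideanSpace ℝ (Fin n))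
    (hstar : F (xstar, u) = 0)
    (x : ℝ → EuclideanSpace ℝ (Fin n))
    (hx : ∀ t : ℝ, HasDerivAt x (F (x t, u)) t) :
    (∀ t : ℝ, 0 ≤ t → ‖x t - xstar‖ ≤ Real.exp (-c * t) * ‖x 0 - xstar‖) ∧
      Tendsto x atTop (nhds xstar) := by
  have key : ∀ y : EuclideanSpace ℝ (Fin n), ⟪y - xstar, F (y, u)⟫ ≤ -c * ‖y - xstar‖ ^ 2 := by
    intro y
    have hg : ∀ s : ℝ, HasDerivAt
        (fun s : ℝ => ⟪y - xstar, F (xstar + s • (y - xstar), u)⟫ + s * (c * ‖y - xstar‖ ^ 2))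
        (⟪y - xstar, J (xstar + s • (y - xstar)) u (y - xstar)⟫ + 1 * (c * ‖y - xstar‖ ^ 2))
        s := by
      intro s
      have h1 : HasDerivAt (fun s : ℝ => xstar + s • (y - xstar)) (y - xstar) s := by
        simpa using ((hasDerivAt_id s).smul_const (y - xstar)).const_add xstar
      have h2 : HasDerivAt (fun s : ℝ => F (xstar + s • (y - xstar), u))
          (J (xstar + s • (y - xstar)) u (y - xstar)) s :=
        HasFDerivAt.comp_hasDerivAt (l := fun y => F (y, u)) s
          (hJ (xstar + s • (y - xstar)) u) h1
      have h3 := (hasDerivAt_const s (y - xstar)).inner ℝ h2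
      simp only [inner_zero_left, add_zero] at h3
      exact h3.add ((hasDerivAt_id s).mul_const _)
    have hanti := antitone_of_hasDerivAt_nonpos hg (fun s => by
      have := hneg (xstar + s • (y - xstar)) u (y - xstar)
      simp only [Pi.zero_apply]
      linarith)
    have h := hanti (zero_le_one (α := ℝ))
    simp [hstar] at h
    linarith
  have hd : ∀ t : ℝ, HasDerivAt (fun t : ℝ => Real.exp (2 * c * t) * ‖x t - xstar‖ ^ 2)
      (Real.exp (2 * c * t) * (2 * c) * ‖x t - xstar‖ ^ 2 +
        Real.exp (2 * c * t) * (2 * ⟪x t - xstar, F (x t, u)⟫)) t := by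
    intro t
    have h1 : HasDerivAt (fun t : ℝ => Real.exp (2 * c * t))
        (Real.exp (2 * c * t) * (2 * c)) t := by
      simpa using ((hasDerivAt_id t).const_mul (2 * c)).exp
    exact h1.mul ((hx t).sub_const xstar).norm_sq
  have hanti := antitone_of_hasDerivAt_nonpos hd (fun t => by
    have h := mul_le_mul_of_nonneg_left (key (x t)) (Real.exp_pos (2 * c * t)).le
    simp only [Pi.zero_apply]
    linarith)
  have main : ∀ t : ℝ, 0 ≤ t → ‖x t - xstar‖ ≤ Real.exp (-c * t) * ‖x 0 - xstar‖ := by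
    intro t ht
    have h := hanti ht
    simp only [mul_zero, Real.exp_zero, one_mul] at h
    have h2 : (Real.exp (c * t) * ‖x t - xstar‖) ^ 2 ≤ ‖x 0 - xstar‖ ^ 2 := by
      have e : 2 * c * t = ((2 : ℕ) : ℝ) * (c * t) := by
        push_cast
        ring
      rw [mul_pow, ← Real.exp_nat_mul, ← e]
      exact h
    have h3 := (pow_le_pow_iff_left₀ (by positivity) (norm_nonneg _) two_ne_zero).mp h2
    have h4 := mul_le_mul_of_nonneg_left h3 (Real.exp_pos (-c * t)).le
    rw [← mul_assoc, ← Real.exp_add] at h4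
    simpa using h4
  refine ⟨main, ?_⟩
  rw [tendsto_iff_norm_sub_tendsto_zero]
  have hlim : Tendsto (fun t : ℝ => Real.exp (-c * t) * ‖x 0 - xstar‖) atTop (nhds 0) := by
    have h1 : Tendsto (fun t : ℝ => -c * t) atTop atBot :=
      tendsto_id.const_mul_atTop_of_neg (neg_lt_zero.mpr hc)
    simpa using (Real.tendsto_exp_atBot.comp h1).mul_const ‖x 0 - xstar‖
  refine tendsto_of_tendsto_of_tendsto_of_le_of_le' tendsto_const_nhds hlim
    (Eventually.of_forall fun t => norm_nonneg _) ?_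
  filter_upwards [eventually_ge_atTop 0] with t ht using main t ht
end
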